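/- Let u,v be positive integers with u ≥ 2 and set t = u/v. For every p ∈ ℂ: (i) f_u(pv/u + 2v/u, h_{u−1,0;pv/u}(t) − pv/u − v/u, t) = C(2(u−1), u−1) · (∏_{j=0}^{u−2} (p + u − 2j)) / (2^{u−1}·(u−1)!), where C(2(u−1),u−1) is the central binomial coefficient; and (ii) 2·h_{u−1,0;pv/u}(t) − pv/u = −(v/(2u))·(p + u)·(p − u + 2). -/

import Mathlib

/-- The recursively defined polynomials `f_n(x,y,z)`:
`f_2 = xz`, `f_3 = x²z²/2 − yz`, and
`f_{n+2} = ((2n+1)xz/(n+1)²) f_{n+1} − ((4yz + x²z² − (n−1)(n+1))/(n+1)²) f_n`. -/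
noncomputable def fpoly : ℕ → ℂ → ℂ → ℂ → ℂ
  | 0, _, _, _ => 0
  | 1, _, _, _ => 0
  | 2, x, _, z => x * z
  | 3, x, y, z => x ^ 2 * z ^ 2 / 2 - y * z
  | n + 4, x, y, z =>
      (2 * ((n : ℂ) + 2) + 1) * x * z / ((n : ℂ) + 3) ^ 2 * fpoly (n + 3) x y z
        - (4 * y * z + x ^ 2 * z ^ 2 - ((n : ℂ) + 1) * ((n : ℂ) + 3)) / ((n : ℂ) + 3) ^ 2 *
            fpoly (n + 2) x y z

/-- `h_{r,s;q}(t) = ((r − ts)² − 1)/(4t) − (t/4) q²`. -/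
noncomputable def hwt (t r s q : ℂ) : ℂ := ((r - t * s) ^ 2 - 1) / (4 * t) - t / 4 * q ^ 2

open Finset in
/-- Coefficient of `s (s - 1) ⋯ (s - k + 1)` in the discrete Chebyshev polynomial of degree `n`
on `N` points, divided by `n!`. -/
noncomputable def chebCoeff (N : ℂ) (n k : ℕ) : ℂ :=
  if k ≤ n then
    (∏ i ∈ range (n - k), ((k : ℂ) + 1 - N + i)) * ((n + k).factorial : ℂ) /
      ((n.factorial : ℂ) * (k.factorial : ℂ) ^ 2 * ((n - k).factorial : ℂ))
  else 0

open Finset in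
/-- The discrete Chebyshev polynomial of degree `n` on `N` points, divided by `n!`. -/
noncomputable def discreteCheb (N s : ℂ) (n : ℕ) : ℂ :=
  ∑ k ∈ range (n + 1), chebCoeff N n k * ∏ j ∈ range k, (s - j)

theorem chebCoeff_eq_zero_of_lt (N : ℂ) {n k : ℕ} (h : n < k) : chebCoeff N n k = 0 :=
  if_neg (not_le.mpr h)

open Finset in
theorem chebCoeff_add (N : ℂ) (k m : ℕ) :
    chebCoeff N (k + m) k =
      (∏ i ∈ range m, ((k : ℂ) + 1 - N + i)) * ((2 * k + m).factorial : ℂ) /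
        (((k + m).factorial : ℂ) * (k.factorial : ℂ) ^ 2 * (m.factorial : ℂ)) := by
  rw [chebCoeff, if_pos (Nat.le_add_right k m), Nat.add_sub_cancel_left,
    show k + m + k = 2 * k + m by ring]

theorem chebCoeff_recurrence_zero (N : ℂ) (n : ℕ) :
    ((n : ℂ) + 2) ^ 2 * chebCoeff N (n + 2) 0 =
      (2 * n + 3) * (1 - N) * chebCoeff N (n + 1) 0
        - (N ^ 2 - (n + 1) ^ 2) * chebCoeff N n 0 := by
  have h (m : ℕ) := chebCoeff_add N 0 m
  simp only [Nat.zero_add, Nat.mul_zero] at h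
  rw [h, h, h]
  have hn : (n.factorial : ℂ) ≠ 0 := by exact_mod_cast n.factorial_ne_zero
  have h1 : (n : ℂ) + 1 ≠ 0 := by exact_mod_cast n.succ_ne_zero
  have h2 : (n : ℂ) + 1 + 1 ≠ 0 := by exact_mod_cast (n + 1).succ_ne_zero
  simp only [Finset.prod_range_succ, Nat.factorial_succ, Nat.factorial_zero]
  push_cast
  field_simp
  ring

open Finset in
theorem chebCoeff_recurrence_succ (N : ℂ) (n k : ℕ) :
    ((n : ℂ) + 2) ^ 2 * chebCoeff N (n + 2) (k + 1) =
      (2 * n + 3) * (2 * chebCoeff N (n + 1) k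
        + (2 * k + 3 - N) * chebCoeff N (n + 1) (k + 1))
        - (N ^ 2 - (n + 1) ^ 2) * chebCoeff N n (k + 1) := by
  have hk : (k.factorial : ℂ) ≠ 0 := by exact_mod_cast k.factorial_ne_zero
  have hk1 : (k : ℂ) + 1 ≠ 0 := by exact_mod_cast k.succ_ne_zero
  rcases lt_or_ge k n with h | h
  · obtain ⟨m, rfl⟩ := Nat.exists_eq_add_of_lt h
    have e1 := chebCoeff_add N (k + 1) (m + 2)
    have e2 := chebCoeff_add N k (m + 2)
    have e3 := chebCoeff_add N (k + 1) (m + 1)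
    have e4 := chebCoeff_add N (k + 1) m
    rw [show k + 1 + (m + 2) = k + m + 1 + 2 by ring,
      show 2 * (k + 1) + (m + 2) = 2 * k + m + 2 + 1 + 1 by ring] at e1
    rw [show k + (m + 2) = k + m + 1 + 1 by ring,
      show 2 * k + (m + 2) = 2 * k + m + 2 by ring, prod_range_succ'] at e2
    rw [show k + 1 + (m + 1) = k + m + 1 + 1 by ring,
      show 2 * (k + 1) + (m + 1) = 2 * k + m + 2 + 1 by ring] at e3
    rw [show k + 1 + m = k + m + 1 by ring,
      show 2 * (k + 1) + m = 2 * k + m + 2 by ring] at e4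
    have hshift : ∏ i ∈ range (m + 1), ((k : ℂ) + 1 - N + (i + 1 : ℕ)) =
        ∏ i ∈ range (m + 1), (((k + 1 : ℕ) : ℂ) + 1 - N + i) :=
      prod_congr rfl fun i _ => by push_cast; ring
    rw [hshift] at e2
    rw [e1, e2, e3, e4]
    have hm : (m.factorial : ℂ) ≠ 0 := by exact_mod_cast m.factorial_ne_zero
    have hkm : ((k + m + 1).factorial : ℂ) ≠ 0 := by
      exact_mod_cast (k + m + 1).factorial_ne_zero
    have hm1 : (m : ℂ) + 1 ≠ 0 := by exact_mod_cast m.succ_ne_zero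
    have hm2 : (m : ℂ) + 1 + 1 ≠ 0 := by exact_mod_cast (m + 1).succ_ne_zero
    have hkm2 : (k : ℂ) + m + 1 + 1 ≠ 0 := by exact_mod_cast (k + m + 1).succ_ne_zero
    have hkm3 : (k : ℂ) + m + 1 + 1 + 1 ≠ 0 := by exact_mod_cast (k + m + 2).succ_ne_zero
    rw [Nat.factorial_succ (k + m + 1 + 1), Nat.factorial_succ (k + m + 1),
      Nat.factorial_succ (2 * k + m + 2 + 1), Nat.factorial_succ (2 * k + m + 2),
      Nat.factorial_succ (m + 1), Nat.factorial_succ m, Nat.factorial_succ k]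
    simp only [prod_range_succ]
    generalize ((2 * k + m + 2).factorial) = F
    generalize ((k + m + 1).factorial) = G at *
    push_cast
    generalize ∏ i ∈ range m, ((k : ℂ) + 1 + 1 - N + i) = P
    field_simp
    ring
  · rcases h.eq_or_lt with rfl | h
    · have e1 := chebCoeff_add N (n + 1) 1
      have e2 := chebCoeff_add N n 1
      have e3 := chebCoeff_add N (n + 1) 0
      rw [chebCoeff_eq_zero_of_lt N (Nat.lt_succ_self n)]
      rw [show n + 1 + 1 = n + 2 by ring,
        show 2 * (n + 1) + 1 = 2 * n + 1 + 1 + 1 by ring] at e1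
      rw [Nat.add_zero, show 2 * (n + 1) + 0 = 2 * n + 1 + 1 by ring] at e3
      rw [e1, e2, e3]
      have hn2 : (n : ℂ) + 1 + 1 ≠ 0 := by exact_mod_cast (n + 1).succ_ne_zero
      simp only [Nat.factorial_succ, prod_range_succ, prod_range_zero, Nat.factorial_zero]
      generalize (2 * n).factorial = F
      push_cast
      field_simp
      ring
    · rw [chebCoeff_eq_zero_of_lt N (show n + 1 < k + 1 by omega),
        chebCoeff_eq_zero_of_lt N (show n < k + 1 by omega)]
      rcases (Nat.succ_le_of_lt h).eq_or_lt with rfl | h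
      · have e1 := chebCoeff_add N (n + 2) 0
        have e2 := chebCoeff_add N (n + 1) 0
        rw [Nat.add_zero, show 2 * (n + 2) + 0 = 2 * n + 2 + 1 + 1 by ring] at e1
        rw [Nat.add_zero, show 2 * (n + 1) + 0 = 2 * n + 2 by ring] at e2
        simp only [Nat.succ_eq_add_one, Nat.add_assoc, Nat.reduceAdd] at *
        rw [e1, e2]
        have hn : (n.factorial : ℂ) ≠ 0 := by exact_mod_cast n.factorial_ne_zero
        have hn1 : (n : ℂ) + 1 ≠ 0 := by exact_mod_cast n.succ_ne_zero
        have hn2 : (n : ℂ) + 1 + 1 ≠ 0 := by exact_mod_cast (n + 1).succ_ne_zero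
        simp only [Nat.factorial_succ, prod_range_zero, Nat.factorial_zero]
        generalize (2 * n).factorial = F
        push_cast
        field_simp
        ring
      · rw [chebCoeff_eq_zero_of_lt N (show n + 2 < k + 1 by omega),
          chebCoeff_eq_zero_of_lt N (show n + 1 < k by omega)]
        ring

open Finset in
theorem discreteCheb_eq_sum_range (N s : ℂ) {n M : ℕ} (h : n + 1 ≤ M) :
    discreteCheb N s n = ∑ k ∈ range M, chebCoeff N n k * ∏ j ∈ range k, (s - j) := by
  refine sum_subset (range_subset_range.mpr h) fun k _ hk => ?_
  rw [chebCoeff_eq_zero_of_lt N (by simpa [Nat.lt_succ_iff] using hk), zero_mul]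

open Finset in
/-- Three-term recurrence of the discrete Chebyshev polynomials. -/
theorem discreteCheb_recurrence (N s : ℂ) (n : ℕ) :
    ((n : ℂ) + 2) ^ 2 * discreteCheb N s (n + 2) =
      (2 * n + 3) * (2 * s - N + 1) * discreteCheb N s (n + 1)
        - (N ^ 2 - (n + 1) ^ 2) * discreteCheb N s n := by
  have hmul : (2 * s - N + 1) * discreteCheb N s (n + 1) =
      ∑ k ∈ range (n + 2), 2 * chebCoeff N (n + 1) k * ∏ j ∈ range (k + 1), (s - j) +
      ∑ k ∈ range (n + 3), (2 * k + 1 - N) * chebCoeff N (n + 1) k *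
        ∏ j ∈ range k, (s - j) := by
    rw [sum_range_succ _ (n + 2), chebCoeff_eq_zero_of_lt N (Nat.lt_succ_self (n + 1)),
      mul_zero, zero_mul, add_zero, ← sum_add_distrib, discreteCheb, mul_sum]
    refine sum_congr rfl fun k _ => ?_
    rw [prod_range_succ]
    ring
  rw [mul_assoc, hmul, discreteCheb, discreteCheb_eq_sum_range N s (show n + 1 ≤ n + 3 by omega),
    sum_range_succ' _ (n + 2), sum_range_succ' _ (n + 2), sum_range_succ' _ (n + 2),
    mul_add, mul_add, mul_add, mul_add, mul_sum, mul_sum, mul_sum, mul_sum]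
  have hsum : ∑ k ∈ range (n + 2), ((n : ℂ) + 2) ^ 2 *
        (chebCoeff N (n + 2) (k + 1) * ∏ j ∈ range (k + 1), (s - j)) =
      ∑ k ∈ range (n + 2), (2 * n + 3) *
        (2 * chebCoeff N (n + 1) k * ∏ j ∈ range (k + 1), (s - j)) +
      ∑ k ∈ range (n + 2), (2 * n + 3) * ((2 * (k + 1 : ℕ) + 1 - N) *
        chebCoeff N (n + 1) (k + 1) * ∏ j ∈ range (k + 1), (s - j)) -
      ∑ k ∈ range (n + 2), (N ^ 2 - (n + 1) ^ 2) *
        (chebCoeff N n (k + 1) * ∏ j ∈ range (k + 1), (s - j)) := by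
    rw [← sum_add_distrib, ← sum_sub_distrib]
    refine sum_congr rfl fun k _ => ?_
    rw [← mul_assoc, chebCoeff_recurrence_succ]
    push_cast
    ring
  rw [hsum, prod_range_zero]
  have h0 := chebCoeff_recurrence_zero N n
  push_cast
  linear_combination h0

theorem discreteCheb_zero (N s : ℂ) : discreteCheb N s 0 = 1 := by
  simp [discreteCheb, chebCoeff]

theorem discreteCheb_one (N s : ℂ) : discreteCheb N s 1 = 2 * s - N + 1 := by
  simp [discreteCheb, chebCoeff, Finset.sum_range_succ]
  ring

open Finset in
/-- The discrete Chebyshev polynomial of degree `N` on `N` points vanishes on all of them. -/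
theorem discreteCheb_self (N : ℕ) (s : ℂ) :
    discreteCheb N s N =
      (Nat.choose (2 * N) N : ℂ) * (∏ j ∈ range N, (s - j)) / (N.factorial : ℂ) := by
  have hN : (N.factorial : ℂ) ≠ 0 := by exact_mod_cast N.factorial_ne_zero
  rw [discreteCheb, sum_range_succ, sum_eq_zero, zero_add]
  · have hc : (Nat.choose (2 * N) N : ℂ) * N.factorial * N.factorial = (2 * N).factorial := by
      have := Nat.choose_mul_factorial_mul_factorial (show N ≤ 2 * N by omega)
      rw [show 2 * N - N = N by omega] at this
      exact_mod_cast this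
    have e := chebCoeff_add N N 0
    simp only [Nat.add_zero] at e
    rw [e, ← hc]
    simp only [prod_range_zero, Nat.factorial_zero, Nat.cast_one]
    field_simp
  · intro k hk
    obtain ⟨m, rfl⟩ := Nat.exists_eq_add_of_lt (mem_range.mp hk)
    have hz : ∏ i ∈ range (m + 1), ((k : ℂ) + 1 - (k + m + 1 : ℕ) + i) = 0 :=
      prod_eq_zero (self_mem_range_succ m) (by push_cast; ring)
    have e := chebCoeff_add ((k + m + 1 : ℕ) : ℂ) k (m + 1)
    rw [hz, zero_mul, zero_div, ← Nat.add_assoc] at e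
    rw [e, zero_mul]

theorem fpoly_eq_discreteCheb {N s x y z : ℂ} (hx : x * z = 2 * s - N + 1)
    (hy : 4 * y * z + x ^ 2 * z ^ 2 = N ^ 2 - 1) (n : ℕ) :
    fpoly (n + 2) x y z = discreteCheb N s (n + 1) := by
  induction n using Nat.twoStepInduction with
  | zero => rw [discreteCheb_one, ← hx]; rfl
  | one =>
    have h := discreteCheb_recurrence N s 0
    rw [discreteCheb_zero, discreteCheb_one, ← hx] at h
    change x ^ 2 * z ^ 2 / 2 - y * z = _
    simp only [Nat.zero_add, Nat.cast_zero] at h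
    linear_combination -h / 4 - hy / 4
  | more n ih ih' =>
    have h := discreteCheb_recurrence N s (n + 1)
    have h3 : (n : ℂ) + 3 ≠ 0 := by exact_mod_cast (n + 2).succ_ne_zero
    rw [← hx] at h
    push_cast at h
    change (2 * ((n : ℂ) + 2) + 1) * x * z / ((n : ℂ) + 3) ^ 2 * fpoly (n + 1 + 2) x y z
        - (4 * y * z + x ^ 2 * z ^ 2 - ((n : ℂ) + 1) * ((n : ℂ) + 3)) / ((n : ℂ) + 3) ^ 2 *
            fpoly (n + 2) x y z = discreteCheb N s (n + 1 + 2)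
    rw [ih, ih', hy]
    field_simp
    linear_combination -h

/-- Closed-form evaluations:
(i) `f_u(pv/u + 2v/u, h_{u−1,0;pv/u}(t) − pv/u − v/u, t)
  = C(2(u−1),u−1) · ∏_{j=0}^{u−2} (p + u − 2j) / (2^{u−1}(u−1)!)`, and
(ii) `2·h_{u−1,0;pv/u}(t) − pv/u = −(v/(2u))·(p+u)·(p−u+2)`, where `t = u/v`. -/
theorem fpoly_top_row_shifted_closed_form (u v : ℕ) (hu : 2 ≤ u) (hv : 1 ≤ v) (p : ℂ) :
    fpoly u (p * (v : ℂ) / (u : ℂ) + 2 * (v : ℂ) / (u : ℂ))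
        (hwt ((u : ℂ) / (v : ℂ)) ((u : ℂ) - 1) 0 (p * (v : ℂ) / (u : ℂ))
          - p * (v : ℂ) / (u : ℂ) - (v : ℂ) / (u : ℂ))
        ((u : ℂ) / (v : ℂ)) =
      (Nat.choose (2 * (u - 1)) (u - 1) : ℂ) *
        (∏ j ∈ Finset.range (u - 1), (p + (u : ℂ) - 2 * (j : ℂ))) /
        (2 ^ (u - 1) * (Nat.factorial (u - 1) : ℂ)) ∧
    2 * hwt ((u : ℂ) / (v : ℂ)) ((u : ℂ) - 1) 0 (p * (v : ℂ) / (u : ℂ))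
        - p * (v : ℂ) / (u : ℂ) =
      -((v : ℂ) / (2 * (u : ℂ))) * (p + (u : ℂ)) * (p - (u : ℂ) + 2) := by
  
  obtain ⟨N, rfl⟩ : ∃ N, u = N + 2 := ⟨u - 2, by omega⟩
  have hv0 : (v : ℂ) ≠ 0 := by exact_mod_cast (show v ≠ 0 by omega)
  have hu0 : (N : ℂ) + 2 ≠ 0 := by exact_mod_cast (N + 1).succ_ne_zero
  constructor
  · rw [fpoly_eq_discreteCheb (N := ((N + 1 : ℕ) : ℂ)) (s := (p + (N + 2 : ℕ)) / 2),
      discreteCheb_self, show N + 2 - 1 = N + 1 by omega]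
    · have hprod : ∏ j ∈ Finset.range (N + 1), (p + ((N + 2 : ℕ) : ℂ) - 2 * (j : ℂ)) =
          2 ^ (N + 1) * ∏ j ∈ Finset.range (N + 1), ((p + ((N + 2 : ℕ) : ℂ)) / 2 - j) := by
        rw [← Finset.card_range (N + 1), ← Finset.prod_const, Finset.card_range,
          ← Finset.prod_mul_distrib]
        exact Finset.prod_congr rfl fun j _ => by ring
      rw [hprod]
      field_simp
    · push_cast
      field_simp
      ring
    · rw [hwt]
      push_cast
      field_simp
      ring
  · rw [hwt]
    push_cast
    field_simp
    ring
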